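/- arXiv:hep-th/0004047 — 9 statements merged into one kernel-verified Lean document; each statement's English description precedes it below -/
import Mathlib

section
/- Let M₀, M₁ be natural numbers, let Z, A : Matrix (Fin M₀) (Fin M₁) ℝ be such that D₁ := Aᵀ * Z is invertible, and set D := 1 - Z * D₁⁻¹ * Aᵀ. Let C, M : Matrix (Fin M₀) (Fin M₀) ℝ be such that C is antisymmetric (Cᵀ = -C), the kernel of C is exactly the column span of Z (for all x : Fin M₀ → ℝ, C.mulVec x = 0 ↔ ∃ w : Fin M₁ → ℝ, x = Z.mulVec w), M * C = D, and M * Z = 0. Then Aᵀ * M = 0. -/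
open Matrix

/-- Over `ℝ`, a vector in the column span of `Z` that is orthogonal to all columns of `Z`
vanishes. -/
theorem mulVec_eq_zero_of_vecMul_eq_zero {m n : Type*} [Fintype m] [Fintype n]
    (Z : Matrix m n ℝ) (w : n → ℝ) (h : (Z *ᵥ w) ᵥ* Z = 0) : Z *ᵥ w = 0 := by
  rw [← dotProduct_self_eq_zero, dotProduct_mulVec, h, zero_dotProduct]

/-- Equation (19): if `C` is the antisymmetric Poisson-bracket matrix whose kernel is
exactly the column span of `Z`, and `M` satisfies `M C = D` and `M Z = 0`,
then `Aᵀ M = 0`. -/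
theorem A_annihilates_M (M₀ M₁ : ℕ) (Z A : Matrix (Fin M₀) (Fin M₁) ℝ)
    (D₁ : Matrix (Fin M₁) (Fin M₁) ℝ) (hD₁ : D₁ = Aᵀ * Z) (hinv : IsUnit D₁.det)
    (D : Matrix (Fin M₀) (Fin M₀) ℝ) (hD : D = 1 - Z * D₁⁻¹ * Aᵀ)
    (C M : Matrix (Fin M₀) (Fin M₀) ℝ)
    (hC : Cᵀ = -C)
    (hker : ∀ x : Fin M₀ → ℝ, C.mulVec x = 0 ↔ ∃ w : Fin M₁ → ℝ, x = Z.mulVec w)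
    (hMC : M * C = D) (hMZ : M * Z = 0) :
    Aᵀ * M = 0 := by
  have hXC : Aᵀ * M * C = 0 := by
    rw [Matrix.mul_assoc, hMC, hD, Matrix.mul_sub, Matrix.mul_one, ← Matrix.mul_assoc,
      ← Matrix.mul_assoc, ← hD₁, mul_nonsing_inv _ hinv, Matrix.one_mul, sub_self]
  have hXZ : Aᵀ * M * Z = 0 := by rw [Matrix.mul_assoc, hMZ, Matrix.mul_zero]
  have hrow : ∀ i, (Aᵀ * M) i = 0 := by
    intro i
    have hxC : (Aᵀ * M) i ᵥ* C = 0 := congrFun hXC i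
    have hxZ : (Aᵀ * M) i ᵥ* Z = 0 := congrFun hXZ i
    have hCx : C *ᵥ (Aᵀ * M) i = 0 := by
      rw [← vecMul_transpose, hC, vecMul_neg, hxC, neg_zero]
    obtain ⟨w, hw⟩ := (hker _).1 hCx
    rw [hw] at hxZ ⊢
    exact mulVec_eq_zero_of_vecMul_eq_zero Z w hxZ
  exact funext hrow
end

section
/- Let M₀, M₁ be natural numbers, let Z, A : Matrix (Fin M₀) (Fin M₁) ℝ be such that D₁ := Aᵀ * Z is invertible, and set D := 1 - Z * D₁⁻¹ * Aᵀ. Let M : Matrix (Fin M₀) (Fin M₀) ℝ be antisymmetric with Aᵀ * M = 0, and let ω : Matrix (Fin M₁) (Fin M₁) ℝ be antisymmetric (ωᵀ = -ω). Define μ := M + Z * D₁⁻¹ * ω * (D₁⁻¹)ᵀ * Zᵀ. Then μ is antisymmetric and D * μ * Dᵀ = M. -/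
open Matrix

/-- Equation (21): `μ = M + Z D₁⁻¹ ω (D₁⁻¹)ᵀ Zᵀ` is antisymmetric and solves
the representation equation `D μ Dᵀ = M`. -/
theorem mu_solves_representation (M₀ M₁ : ℕ) (Z A : Matrix (Fin M₀) (Fin M₁) ℝ)
    (D₁ : Matrix (Fin M₁) (Fin M₁) ℝ) (hD₁ : D₁ = Aᵀ * Z) (hinv : IsUnit D₁.det)
    (D : Matrix (Fin M₀) (Fin M₀) ℝ) (hD : D = 1 - Z * D₁⁻¹ * Aᵀ)
    (M : Matrix (Fin M₀) (Fin M₀) ℝ) (hM : Mᵀ = -M) (hAM : Aᵀ * M = 0)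
    (ω : Matrix (Fin M₁) (Fin M₁) ℝ) (hω : ωᵀ = -ω)
    (μ : Matrix (Fin M₀) (Fin M₀) ℝ) (hμ : μ = M + Z * D₁⁻¹ * ω * (D₁⁻¹)ᵀ * Zᵀ) :
    μᵀ = -μ ∧ D * μ * Dᵀ = M := by
  have hDZ : D * Z = 0 := by
    rw [hD, Matrix.sub_mul, Matrix.one_mul, Matrix.mul_assoc, ← hD₁,
      Matrix.nonsing_inv_mul_cancel_right _ _ hinv, sub_self]
  have hDM : D * M = M := by
    rw [hD, Matrix.sub_mul, Matrix.one_mul, Matrix.mul_assoc, hAM, Matrix.mul_zero, sub_zero]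
  have hMD : M * Dᵀ = M := by
    have h := congrArg Matrix.transpose hDM
    rwa [Matrix.transpose_mul, hM, Matrix.neg_mul, neg_inj] at h
  constructor
  · rw [hμ]
    simp only [Matrix.transpose_add, Matrix.transpose_mul, Matrix.transpose_transpose, hM, hω,
      Matrix.neg_mul, Matrix.mul_neg, Matrix.mul_assoc, neg_add]
  · rw [hμ, Matrix.mul_add, hDM]
    simp only [← Matrix.mul_assoc, hDZ, Matrix.zero_mul, add_zero, hMD]
end

section
/- Let M₀, M₁ be natural numbers, let Z, A : Matrix (Fin M₀) (Fin M₁) ℝ be such that D₁ := Aᵀ * Z is invertible. Let M : Matrix (Fin M₀) (Fin M₀) ℝ be antisymmetric whose kernel is exactly the column span of A (for all x : Fin M₀ → ℝ, M.mulVec x = 0 ↔ ∃ w : Fin M₁ → ℝ, x = A.mulVec w), and let ω : Matrix (Fin M₁) (Fin M₁) ℝ be antisymmetric and invertible. Then μ := M + Z * D₁⁻¹ * ω * (D₁⁻¹)ᵀ * Zᵀ is invertible. -/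
open Matrix

/-- The invertibility argument of Theorem 1: if the antisymmetric `M` has kernel
exactly the column span of `A`, and `ω` is antisymmetric and invertible, then
`μ = M + Z D₁⁻¹ ω (D₁⁻¹)ᵀ Zᵀ` is invertible. -/
theorem mu_invertible (M₀ M₁ : ℕ) (Z A : Matrix (Fin M₀) (Fin M₁) ℝ)
    (D₁ : Matrix (Fin M₁) (Fin M₁) ℝ) (hD₁ : D₁ = Aᵀ * Z) (hinv : IsUnit D₁.det)
    (M : Matrix (Fin M₀) (Fin M₀) ℝ) (hM : Mᵀ = -M)
    (hker : ∀ x : Fin M₀ → ℝ, M.mulVec x = 0 ↔ ∃ w : Fin M₁ → ℝ, x = A.mulVec w)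
    (ω : Matrix (Fin M₁) (Fin M₁) ℝ) (hω : ωᵀ = -ω) (hωinv : IsUnit ω.det)
    (μ : Matrix (Fin M₀) (Fin M₀) ℝ) (hμ : μ = M + Z * D₁⁻¹ * ω * (D₁⁻¹)ᵀ * Zᵀ) :
    IsUnit μ.det := by
  have hMA : M * A = 0 := Matrix.ext_of_mulVec_single fun j => by
    rw [← mulVec_mulVec, zero_mulVec]
    exact (hker _).2 ⟨_, rfl⟩
  have hAM : Aᵀ * M = 0 := by
    have h := congrArg transpose hMA
    rwa [transpose_mul, hM, Matrix.mul_neg, transpose_zero, neg_eq_zero] at h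
  have hAμ : Aᵀ * μ = ω * (D₁⁻¹)ᵀ * Zᵀ := by
    rw [hμ, Matrix.mul_add, hAM, zero_add]
    simp only [← Matrix.mul_assoc]
    rw [← hD₁, mul_nonsing_inv _ hinv, Matrix.one_mul]
  have hZA : (D₁⁻¹)ᵀ * (Zᵀ * A) = 1 := by
    have hDt : Zᵀ * A = D₁ᵀ := by rw [hD₁, transpose_mul, transpose_transpose]
    rw [hDt, ← transpose_mul, mul_nonsing_inv _ hinv, transpose_one]
  rw [isUnit_iff_ne_zero]
  intro hdet
  obtain ⟨x, hx0, hx⟩ := exists_mulVec_eq_zero_iff.2 hdet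
  have hωx : (ω * (D₁⁻¹)ᵀ * Zᵀ) *ᵥ x = 0 := by
    rw [← hAμ, ← mulVec_mulVec, hx, mulVec_zero]
  have hMx : M *ᵥ x = 0 := by
    have hμ' : μ = M + Z * D₁⁻¹ * (ω * (D₁⁻¹)ᵀ * Zᵀ) := by
      simp only [hμ, Matrix.mul_assoc]
    rwa [hμ', add_mulVec, ← mulVec_mulVec, hωx, mulVec_zero, add_zero] at hx
  obtain ⟨w, rfl⟩ := (hker x).1 hMx
  have hωw : ω *ᵥ w = 0 := by
    rwa [mulVec_mulVec, Matrix.mul_assoc, Matrix.mul_assoc, hZA, Matrix.mul_one] at hωx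
  have hw : w = 0 := by
    by_contra hne
    exact hωinv.ne_zero (exists_mulVec_eq_zero_iff.1 ⟨w, hne, hωw⟩)
  exact hx0 (by rw [hw, mulVec_zero])
end

section
/- Let M₀, M₁ be natural numbers, let Z, A : Matrix (Fin M₀) (Fin M₁) ℝ be such that D₁ := Aᵀ * Z is invertible, and set D := 1 - Z * D₁⁻¹ * Aᵀ. Let M : Matrix (Fin M₀) (Fin M₀) ℝ be antisymmetric whose kernel is exactly the column span of A (for all x, M.mulVec x = 0 ↔ ∃ w, x = A.mulVec w). If there exists an invertible antisymmetric matrix ω : Matrix (Fin M₁) (Fin M₁) ℝ, then there exists an invertible antisymmetric matrix μ : Matrix (Fin M₀) (Fin M₀) ℝ such that M = D * μ * Dᵀ. -/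
open Matrix

/-- Theorem 1 (algebraic core): there exists an invertible antisymmetric matrix `μ`
such that `M = D μ Dᵀ`. -/
theorem exists_invertible_antisymmetric_mu (M₀ M₁ : ℕ)
    (Z A : Matrix (Fin M₀) (Fin M₁) ℝ)
    (D₁ : Matrix (Fin M₁) (Fin M₁) ℝ) (hD₁ : D₁ = Aᵀ * Z) (hinv : IsUnit D₁.det)
    (D : Matrix (Fin M₀) (Fin M₀) ℝ) (hD : D = 1 - Z * D₁⁻¹ * Aᵀ)
    (M : Matrix (Fin M₀) (Fin M₀) ℝ) (hM : Mᵀ = -M)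
    (hker : ∀ x : Fin M₀ → ℝ, M.mulVec x = 0 ↔ ∃ w : Fin M₁ → ℝ, x = A.mulVec w)
    (hω : ∃ ω : Matrix (Fin M₁) (Fin M₁) ℝ, ωᵀ = -ω ∧ IsUnit ω.det) :
    ∃ μ : Matrix (Fin M₀) (Fin M₀) ℝ,
      μᵀ = -μ ∧ IsUnit μ.det ∧ M = D * μ * Dᵀ := by
  subst hD₁ hD
  obtain ⟨ω, hωT, hωdet⟩ := hω
  have hMA : M * A = 0 := by
    refine ext_of_mulVec_single fun j => ?_
    rw [← mulVec_mulVec, zero_mulVec]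
    exact (hker _).2 ⟨_, rfl⟩
  have hAM : Aᵀ * M = 0 := by
    have h : (M * A)ᵀ = 0 := by rw [hMA, transpose_zero]
    rwa [transpose_mul, hM, Matrix.mul_neg, neg_eq_zero] at h
  have hDM : (1 - Z * (Aᵀ * Z)⁻¹ * Aᵀ) * M = M := by
    rw [Matrix.sub_mul, Matrix.one_mul, Matrix.mul_assoc _ Aᵀ, hAM, Matrix.mul_zero, sub_zero]
  have hMD : M * (1 - Z * (Aᵀ * Z)⁻¹ * Aᵀ)ᵀ = M := by
    have h := congrArg transpose hDM
    rwa [transpose_mul, hM, Matrix.neg_mul, neg_inj] at h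
  have hDZ : (1 - Z * (Aᵀ * Z)⁻¹ * Aᵀ) * Z = 0 := by
    rw [Matrix.sub_mul, Matrix.one_mul, Matrix.mul_assoc _ Aᵀ, Matrix.mul_assoc Z,
      nonsing_inv_mul _ hinv, Matrix.mul_one, sub_self]
  refine ⟨M + Z * ω * Zᵀ, ?_, ?_, ?_⟩
  · rw [transpose_add, transpose_mul, transpose_mul, transpose_transpose, hM, hωT,
      Matrix.neg_mul, Matrix.mul_neg, Matrix.mul_assoc, neg_add]
  · rw [← isUnit_iff_isUnit_det, ← mulVec_injective_iff_isUnit,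
      ← coe_mulVecLin, ← LinearMap.ker_eq_bot, LinearMap.ker_eq_bot']
    intro x hx
    rw [mulVecLin_apply] at hx
    have hZx : Zᵀ *ᵥ x = 0 := by
      have h : (Aᵀ * Z * ω) *ᵥ (Zᵀ *ᵥ x) = 0 := by
        have h := congrArg (Aᵀ *ᵥ ·) hx
        simpa only [mulVec_mulVec, Matrix.mul_add, hAM, zero_add, ← Matrix.mul_assoc,
          mulVec_zero] using h
      refine eq_zero_of_mulVec_eq_zero ?_ h
      rw [det_mul]
      exact (hinv.mul hωdet).ne_zero
    have hMx : M *ᵥ x = 0 := by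
      rwa [add_mulVec, ← mulVec_mulVec, hZx, mulVec_zero, add_zero] at hx
    obtain ⟨w, rfl⟩ := (hker x).1 hMx
    have hw : w = 0 := by
      refine eq_zero_of_mulVec_eq_zero (M := (Aᵀ * Z)ᵀ) ?_ ?_
      · rw [det_transpose]
        exact hinv.ne_zero
      · rwa [transpose_mul, transpose_transpose, ← mulVec_mulVec]
    rw [hw, mulVec_zero]
  · rw [Matrix.mul_add, hDM, ← Matrix.mul_assoc, ← Matrix.mul_assoc, hDZ, Matrix.zero_mul,
      Matrix.zero_mul, add_zero, hMD]
end

section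
/- Let M₀, M₁ be natural numbers, let Z, A : Matrix (Fin M₀) (Fin M₁) ℝ be such that D₁ := Aᵀ * Z is invertible, and set D := 1 - Z * D₁⁻¹ * Aᵀ. Let C, M : Matrix (Fin M₀) (Fin M₀) ℝ satisfy: C is antisymmetric, C * Z = 0, M * C = D, and M * A = 0. Let ω : Matrix (Fin M₁) (Fin M₁) ℝ be antisymmetric and invertible. Then (M + Z * D₁⁻¹ * ω * (D₁⁻¹)ᵀ * Zᵀ) * (C + A * ω⁻¹ * Aᵀ) = 1, i.e. the matrix C + A * ω⁻¹ * Aᵀ is the inverse of μ := M + Z * D₁⁻¹ * ω * (D₁⁻¹)ᵀ * Zᵀ. -/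
open Matrix

/-- Equation (23): `C + A ω⁻¹ Aᵀ` is the inverse of `μ = M + Z D₁⁻¹ ω (D₁⁻¹)ᵀ Zᵀ`. -/
theorem mu_inverse (M₀ M₁ : ℕ) (Z A : Matrix (Fin M₀) (Fin M₁) ℝ)
    (D₁ : Matrix (Fin M₁) (Fin M₁) ℝ) (hD₁ : D₁ = Aᵀ * Z) (hinv : IsUnit D₁.det)
    (D : Matrix (Fin M₀) (Fin M₀) ℝ) (hD : D = 1 - Z * D₁⁻¹ * Aᵀ)
    (C M : Matrix (Fin M₀) (Fin M₀) ℝ)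
    (hC : Cᵀ = -C) (hCZ : C * Z = 0) (hMC : M * C = D) (hMA : M * A = 0)
    (ω : Matrix (Fin M₁) (Fin M₁) ℝ) (hω : ωᵀ = -ω) (hωinv : IsUnit ω.det) :
    (M + Z * D₁⁻¹ * ω * (D₁⁻¹)ᵀ * Zᵀ) * (C + A * ω⁻¹ * Aᵀ) = 1 := by
  have hZC : Zᵀ * C = 0 := by
    have h := congrArg transpose hCZ
    rwa [transpose_mul, hC, Matrix.mul_neg, transpose_zero, neg_eq_zero] at h
  have hZA : (D₁⁻¹)ᵀ * (Zᵀ * A) = 1 := by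
    have h : Zᵀ * A = D₁ᵀ := by rw [hD₁, transpose_mul, transpose_transpose]
    rw [h, ← transpose_mul, mul_nonsing_inv _ hinv, transpose_one]
  have hμC : Z * D₁⁻¹ * ω * (D₁⁻¹)ᵀ * Zᵀ * C = 0 := by
    rw [Matrix.mul_assoc, hZC, Matrix.mul_zero]
  have hMA' : M * (A * ω⁻¹ * Aᵀ) = 0 := by
    rw [← Matrix.mul_assoc, ← Matrix.mul_assoc, hMA, Matrix.zero_mul, Matrix.zero_mul]
  have hμA : Z * D₁⁻¹ * ω * (D₁⁻¹)ᵀ * Zᵀ * (A * ω⁻¹ * Aᵀ) = Z * D₁⁻¹ * Aᵀ := by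
    calc Z * D₁⁻¹ * ω * (D₁⁻¹)ᵀ * Zᵀ * (A * ω⁻¹ * Aᵀ)
        = Z * D₁⁻¹ * (ω * ((D₁⁻¹)ᵀ * (Zᵀ * A)) * ω⁻¹) * Aᵀ := by
          simp only [Matrix.mul_assoc]
      _ = Z * D₁⁻¹ * Aᵀ := by
          rw [hZA, Matrix.mul_one, mul_nonsing_inv _ hωinv, Matrix.mul_one]
  rw [Matrix.add_mul, Matrix.mul_add, Matrix.mul_add, hMC, hMA', hμC, hμA, hD, add_zero,
    zero_add, sub_add_cancel]
end

section
/- Let M₀, M₁ be natural numbers, let Z, A : Matrix (Fin M₀) (Fin M₁) ℝ be such that D₁ := Aᵀ * Z is invertible, and set D := 1 - Z * D₁⁻¹ * Aᵀ. Let C : Matrix (Fin M₀) (Fin M₀) ℝ be antisymmetric with C * Z = 0, and let σ : Matrix (Fin M₁) (Fin M₁) ℝ be arbitrary. Then Dᵀ * (C + A * σ * Aᵀ) * D = C. -/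
open Matrix

/-- Equation (22): the Poisson-bracket matrix `C` is represented as
`Dᵀ (C + A σ Aᵀ) D = C`. -/
theorem C_representation (M₀ M₁ : ℕ) (Z A : Matrix (Fin M₀) (Fin M₁) ℝ)
    (D₁ : Matrix (Fin M₁) (Fin M₁) ℝ) (hD₁ : D₁ = Aᵀ * Z) (hinv : IsUnit D₁.det)
    (D : Matrix (Fin M₀) (Fin M₀) ℝ) (hD : D = 1 - Z * D₁⁻¹ * Aᵀ)
    (C : Matrix (Fin M₀) (Fin M₀) ℝ) (hC : Cᵀ = -C) (hCZ : C * Z = 0)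
    (σ : Matrix (Fin M₁) (Fin M₁) ℝ) :
    Dᵀ * (C + A * σ * Aᵀ) * D = C := by
  have hCD : C * D = C := by
    rw [hD, Matrix.mul_sub, Matrix.mul_one, ← Matrix.mul_assoc, ← Matrix.mul_assoc, hCZ,
      Matrix.zero_mul, Matrix.zero_mul, sub_zero]
  have hAD : Aᵀ * D = 0 := by
    rw [hD, Matrix.mul_sub, Matrix.mul_one, ← Matrix.mul_assoc, ← Matrix.mul_assoc, ← hD₁,
      Matrix.mul_nonsing_inv _ hinv, Matrix.one_mul, sub_self]
  have hDC : Dᵀ * C = C := by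
    have h := congrArg Matrix.transpose hCD
    rwa [Matrix.transpose_mul, hC, Matrix.mul_neg, neg_inj] at h
  rw [Matrix.mul_assoc, Matrix.add_mul, hCD, Matrix.mul_assoc (A * σ), hAD, Matrix.mul_zero,
    add_zero, hDC]
end

section
/- Let M₀, M₁ be natural numbers, let Z, A : Matrix (Fin M₀) (Fin M₁) ℝ be such that D₁ := Aᵀ * Z is invertible. Let M : Matrix (Fin M₀) (Fin M₀) ℝ satisfy M * A = 0 and Aᵀ * M = 0, and let ω : Matrix (Fin M₁) (Fin M₁) ℝ be antisymmetric. Define μ := M + Z * D₁⁻¹ * ω * (D₁⁻¹)ᵀ * Zᵀ. Then Aᵀ * μ * A = ω. -/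
open Matrix

/-- Equation (40): `Aᵀ μ A = ω`. -/
theorem A_mu_A (M₀ M₁ : ℕ) (Z A : Matrix (Fin M₀) (Fin M₁) ℝ)
    (D₁ : Matrix (Fin M₁) (Fin M₁) ℝ) (hD₁ : D₁ = Aᵀ * Z) (hinv : IsUnit D₁.det)
    (M : Matrix (Fin M₀) (Fin M₀) ℝ) (hMA : M * A = 0) (hAM : Aᵀ * M = 0)
    (ω : Matrix (Fin M₁) (Fin M₁) ℝ) (hω : ωᵀ = -ω)
    (μ : Matrix (Fin M₀) (Fin M₀) ℝ) (hμ : μ = M + Z * D₁⁻¹ * ω * (D₁⁻¹)ᵀ * Zᵀ) :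
    Aᵀ * μ * A = ω := by
  have hDt : Zᵀ * A = D₁ᵀ := by rw [hD₁, transpose_mul, transpose_transpose]
  have hinv_t : (D₁⁻¹)ᵀ * D₁ᵀ = 1 := by
    rw [← transpose_mul, mul_nonsing_inv _ hinv, transpose_one]
  calc Aᵀ * μ * A
      = Aᵀ * M * A + (Aᵀ * Z) * D₁⁻¹ * ω * ((D₁⁻¹)ᵀ * (Zᵀ * A)) := by
        simp only [hμ, Matrix.mul_add, Matrix.add_mul, Matrix.mul_assoc]
    _ = ω := by
        rw [hAM, hDt, hinv_t, ← hD₁, mul_nonsing_inv _ hinv, Matrix.zero_mul, zero_add,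
          Matrix.one_mul, Matrix.mul_one]
end

section
/- Let M₀, M₁ be natural numbers, let Z, A : Matrix (Fin M₀) (Fin M₁) ℝ be such that D₁ := Aᵀ * Z is invertible. Let M : Matrix (Fin M₀) (Fin M₀) ℝ satisfy M * A = 0 and Aᵀ * M = 0, and let ω : Matrix (Fin M₁) (Fin M₁) ℝ be antisymmetric. Define μ := M + Z * D₁⁻¹ * ω * (D₁⁻¹)ᵀ * Zᵀ. Then for all f, g : Fin M₀ → ℝ with Zᵀ.mulVec f = 0 and Zᵀ.mulVec g = 0, and all u, v : Fin M₁ → ℝ, one has (f + A.mulVec u) ⬝ᵥ μ.mulVec (g + A.mulVec v) = f ⬝ᵥ M.mulVec g + u ⬝ᵥ ω.mulVec v. -/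
open Matrix

/-- If `Zᵀ f = 0`, the matrix `(Z (Aᵀ Z)⁻¹)ᵀ` recovers `u` from `f + A u`. -/
theorem Matrix.transpose_mul_inv_mulVec_add {m n R : Type*} [Fintype m] [Fintype n]
    [DecidableEq n] [CommRing R] {Z A : Matrix m n R} (hinv : IsUnit (Aᵀ * Z).det)
    {f : m → R} (hf : Zᵀ *ᵥ f = 0) (u : n → R) :
    (Z * (Aᵀ * Z)⁻¹)ᵀ *ᵥ (f + A *ᵥ u) = u := by
  have hA : (Z * (Aᵀ * Z)⁻¹)ᵀ * A = 1 := by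
    rw [← transpose_transpose A, ← transpose_mul, transpose_transpose, ← Matrix.mul_assoc,
      mul_nonsing_inv _ hinv, transpose_one]
  rw [mulVec_add, mulVec_mulVec, hA, one_mulVec, transpose_mul, ← mulVec_mulVec, hf,
    mulVec_zero, zero_add]

/-- Theorem 2(ii), equations (38)-(40): the irreducible Dirac bracket coincides with
the extended reducible one on the constraint surface. -/
theorem irreducible_dirac_bracket (M₀ M₁ : ℕ) (Z A : Matrix (Fin M₀) (Fin M₁) ℝ)
    (D₁ : Matrix (Fin M₁) (Fin M₁) ℝ) (hD₁ : D₁ = Aᵀ * Z) (hinv : IsUnit D₁.det)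
    (M : Matrix (Fin M₀) (Fin M₀) ℝ) (hMA : M * A = 0) (hAM : Aᵀ * M = 0)
    (ω : Matrix (Fin M₁) (Fin M₁) ℝ) (hω : ωᵀ = -ω)
    (μ : Matrix (Fin M₀) (Fin M₀) ℝ) (hμ : μ = M + Z * D₁⁻¹ * ω * (D₁⁻¹)ᵀ * Zᵀ) :
    ∀ (f g : Fin M₀ → ℝ), Zᵀ.mulVec f = 0 → Zᵀ.mulVec g = 0 →
      ∀ (u v : Fin M₁ → ℝ),
        (f + A.mulVec u) ⬝ᵥ μ.mulVec (g + A.mulVec v) =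
          f ⬝ᵥ M.mulVec g + u ⬝ᵥ ω.mulVec v := by
  intro f g hf hg u v
  subst hD₁ hμ
  have hM : (f + A *ᵥ u) ⬝ᵥ M *ᵥ (g + A *ᵥ v) = f ⬝ᵥ M *ᵥ g := by
    have hu : (A *ᵥ u) ⬝ᵥ M *ᵥ g = 0 := by
      rw [← vecMul_transpose, ← dotProduct_mulVec, mulVec_mulVec, hAM, zero_mulVec,
        dotProduct_zero]
    rw [mulVec_add, mulVec_mulVec, hMA, zero_mulVec, add_zero, add_dotProduct, hu, add_zero]
  rw [Matrix.mul_assoc _ _ Zᵀ, ← transpose_mul, add_mulVec, dotProduct_add, hM,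
    ← mulVec_mulVec, transpose_mul_inv_mulVec_add hinv hg, ← mulVec_mulVec,
    dotProduct_mulVec (f + A *ᵥ u), ← mulVec_transpose,
    transpose_mul_inv_mulVec_add hinv hf]
end

section
/- Let M₀, M₁ be natural numbers, let Z, A : Matrix (Fin M₀) (Fin M₁) ℝ be such that D₁ := Aᵀ * Z is invertible, and set D := 1 - Z * D₁⁻¹ * Aᵀ. Let χ : Fin M₀ → ℝ satisfy Zᵀ.mulVec χ = 0, let y : Fin M₁ → ℝ, and set χ̃ := χ + A.mulVec y. Then Dᵀ.mulVec χ̃ = χ and (D₁ᵀ)⁻¹.mulVec (Zᵀ.mulVec χ̃) = y. -/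
open Matrix

/-- Equation (36): recovering the original constraints `χ` and the new variables `y`
from the irreducible constraint functions `χ̃ = χ + A y`. -/
theorem recover_constraints (M₀ M₁ : ℕ) (Z A : Matrix (Fin M₀) (Fin M₁) ℝ)
    (D₁ : Matrix (Fin M₁) (Fin M₁) ℝ) (hD₁ : D₁ = Aᵀ * Z) (hinv : IsUnit D₁.det)
    (D : Matrix (Fin M₀) (Fin M₀) ℝ) (hD : D = 1 - Z * D₁⁻¹ * Aᵀ)
    (χ : Fin M₀ → ℝ) (hχ : Zᵀ.mulVec χ = 0) (y : Fin M₁ → ℝ)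
    (χt : Fin M₀ → ℝ) (hχt : χt = χ + A.mulVec y) :
    Dᵀ.mulVec χt = χ ∧ (D₁ᵀ)⁻¹.mulVec (Zᵀ.mulVec χt) = y := by
  have hZ : Zᵀ *ᵥ χt = D₁ᵀ *ᵥ y := by
    rw [hχt, mulVec_add, hχ, zero_add, mulVec_mulVec, hD₁, transpose_mul, transpose_transpose]
  have hy : (D₁ᵀ)⁻¹ *ᵥ (Zᵀ *ᵥ χt) = y := by
    rw [hZ, mulVec_mulVec, nonsing_inv_mul _ (isUnit_det_transpose _ hinv), one_mulVec]
  have hDt : Dᵀ = 1 - A * ((D₁ᵀ)⁻¹ * Zᵀ) := by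
    rw [hD, transpose_sub, transpose_one, transpose_mul, transpose_mul, transpose_transpose,
      transpose_nonsing_inv]
  refine ⟨?_, hy⟩
  rw [hDt, sub_mulVec, one_mulVec, ← mulVec_mulVec, ← mulVec_mulVec, hy, hχt, add_sub_cancel_right]
end
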